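/- Let C = C_1 ∧ ⋯ ∧ C_M be a Boolean formula in conjunctive normal form over variables x_1, …, x_n, and let G_C be the latent-factor graph with distinguished observed node v constructed from C as described. Then C is satisfiable if and only if there exists a triple (Y, Z, H) satisfying the latent-factor half-trek criterion with respect to v in G_C. (This yields a polynomial-time reduction from CNF satisfiability, so deciding solvability of the LF-HTC is NP-hard.) -/

import Mathlib

open scoped Classical
open Matrix

namespace LFG

variable {V L : Type*} [DecidableEq V] [DecidableEq L]

/-- Observed parents of a node `v`: nodes `w` with `w → v` in `D_V`. -/
def paV (DV : Finset (V × V)) (v : V) : Finset V :=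
  (DV.filter fun e => e.2 = v).image Prod.fst

/-- Latent parents of a set `W` of observed nodes. -/
def paL (DLV : Finset (L × V)) (W : Finset V) : Finset L :=
  (DLV.filter fun e => e.2 ∈ W).image Prod.fst

/-- Observed children of a set `H` of latent nodes. -/
def chL (DLV : Finset (L × V)) (H : Finset L) : Finset V :=
  (DLV.filter fun e => e.1 ∈ H).image Prod.snd

/-- A latent-factor half-trek: either a directed path
`source → x₁ → ⋯ → xₙ → target` (when `latent = none`, with node list
`source :: tail`), or `source ← h → x₁ → ⋯ → xₙ → target`
(when `latent = some h`, with observed node list `tail ≠ []`).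
Trivial half-treks (`latent = none`, `tail = []`) are allowed. -/
structure HalfTrek (DV : Finset (V × V)) (DLV : Finset (L × V)) where
  source : V
  latent : Option L
  tail : List V
  chain : List.Chain' (fun a b => (a, b) ∈ DV) tail
  src_edge : latent = none → ∀ x ∈ tail.head?, (source, x) ∈ DV
  latent_src : ∀ h, latent = some h → (h, source) ∈ DLV
  latent_head : ∀ h, latent = some h → ∃ x, tail.head? = some x ∧ (h, x) ∈ DLV

variable {DV : Finset (V × V)} {DLV : Finset (L × V)}

/-- The target of a half-trek. -/
def HalfTrek.target (t : HalfTrek DV DLV) : V := t.tail.getLastD t.source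

/-- Observed part of the left-hand side of a half-trek. -/
def HalfTrek.leftV (t : HalfTrek DV DLV) : Finset V := {t.source}

/-- Latent node of a half-trek (both on its left- and right-hand side). -/
def HalfTrek.lats (t : HalfTrek DV DLV) : Finset L := t.latent.toFinset

/-- Observed part of the right-hand side of a half-trek. -/
def HalfTrek.rightV (t : HalfTrek DV DLV) : Finset V :=
  match t.latent with
  | none => insert t.source t.tail.toFinset
  | some _ => t.tail.toFinset

/-- The half-trek avoids all latent nodes in `H`. -/
def HalfTrek.Avoids (t : HalfTrek DV DLV) (H : Finset L) : Prop :=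
  ∀ h, t.latent = some h → h ∉ H

/-- `w` is half-trek reachable from `u` while avoiding `H` (for distinct `u ≠ w`). -/
def HtrFrom (DV : Finset (V × V)) (DLV : Finset (L × V)) (H : Finset L) (u w : V) : Prop :=
  u ≠ w ∧ ∃ t : HalfTrek DV DLV, t.source = u ∧ t.target = w ∧ t.Avoids H

/-- `w ∈ htr_H(U)`. -/
def HtrReach (DV : Finset (V × V)) (DLV : Finset (L × V)) (H : Finset L)
    (U : Finset V) (w : V) : Prop :=
  ∃ u ∈ U, HtrFrom DV DLV H u w

/-- Two half-treks have no sided intersection. -/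
def NSI (t₁ t₂ : HalfTrek DV DLV) : Prop :=
  Disjoint t₁.leftV t₂.leftV ∧ Disjoint t₁.lats t₂.lats ∧ Disjoint t₁.rightV t₂.rightV

/-- A system of latent-factor half-treks with no sided intersection from `Y` to `T`,
indexed by targets. -/
def IsHTSystem (DV : Finset (V × V)) (DLV : Finset (L × V)) (Y T : Finset V)
    (f : V → HalfTrek DV DLV) : Prop :=
  (∀ b ∈ T, (f b).target = b) ∧
  T.image (fun b => (f b).source) = Y ∧
  ∀ b₁ ∈ T, ∀ b₂ ∈ T, b₁ ≠ b₂ → NSI (f b₁) (f b₂)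

/-- The triple `(Y, Z, H)` satisfies the latent-factor half-trek criterion (LF-HTC)
with respect to `v`. -/
def SatisfiesLFHTC (DV : Finset (V × V)) (DLV : Finset (L × V)) (v : V)
    (Y Z : Finset V) (H : Finset L) : Prop :=
  v ∉ Y ∧ v ∉ Z ∧
  Y.card = (paV DV v).card + H.card ∧
  Z.card = H.card ∧
  Disjoint Z (paV DV v) ∧
  Disjoint Y (insert v Z) ∧
  (paL DLV Y ∩ paL DLV (insert v Z) ⊆ H) ∧
  ∃ f : V → HalfTrek DV DLV,
    IsHTSystem DV DLV Y (Z ∪ paV DV v) f ∧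
    ∀ z ∈ Z, ∃ h ∈ H, (f z).latent = some h ∧ (f z).tail = [z]

section Matrices

variable [Fintype V] [Fintype L]

/-- The observed covariance matrix `Σ = (I-Λ)^{-⊤} (Ω_diag + Γ^⊤Γ) (I-Λ)^{-1}`. -/
noncomputable def SigmaMat (Λ : Matrix V V ℝ) (Γ : Matrix L V ℝ) (ω : V → ℝ) :
    Matrix V V ℝ :=
  ((1 - Λ)ᵀ)⁻¹ * (Matrix.diagonal ω + Γᵀ * Γ) * (1 - Λ)⁻¹

/-- The parameters `(Λ, Γ, Ω_diag)` belong to `ℝ^{D_V}_reg × ℝ^{D_{ℒV}} × diag⁺_d`. -/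
def GoodParams (DV : Finset (V × V)) (DLV : Finset (L × V))
    (Λ : Matrix V V ℝ) (Γ : Matrix L V ℝ) (ω : V → ℝ) : Prop :=
  (∀ a b : V, (a, b) ∉ DV → Λ a b = 0) ∧
  IsUnit (1 - Λ) ∧
  (∀ h a, (h, a) ∉ DLV → Γ h a = 0) ∧
  (∀ a, 0 < ω a)

/-- Index type for the free parameter coordinates of `(Λ, Γ, Ω_diag)`. -/
abbrev ParamVar (DV : Finset (V × V)) (DLV : Finset (L × V)) : Type _ :=
  {e : V × V // e ∈ DV} ⊕ {e : L × V // e ∈ DLV} ⊕ V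

/-- Evaluation of the parameter coordinates. -/
def evalParam (DV : Finset (V × V)) (DLV : Finset (L × V))
    (Λ : Matrix V V ℝ) (Γ : Matrix L V ℝ) (ω : V → ℝ) : ParamVar DV DLV → ℝ
  | Sum.inl e => Λ e.1.1 e.1.2
  | Sum.inr (Sum.inl e) => Γ e.1.1 e.1.2
  | Sum.inr (Sum.inr a) => ω a

/-- Evaluation of the entries of `Σ`. -/
noncomputable def sigmaEval (Λ : Matrix V V ℝ) (Γ : Matrix L V ℝ) (ω : V → ℝ) :
    V × V → ℝ := fun e => SigmaMat Λ Γ ω e.1 e.2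

/-- The direct effect `λ_{wv}` (the edge `w → v`) is rationally identifiable. -/
def RatIdent (DV : Finset (V × V)) (DLV : Finset (L × V)) (w v : V) : Prop :=
  ∃ (p q : MvPolynomial (V × V) ℝ) (g : MvPolynomial (ParamVar DV DLV) ℝ),
    g ≠ 0 ∧
    ∀ (Λ : Matrix V V ℝ) (Γ : Matrix L V ℝ) (ω : V → ℝ),
      GoodParams DV DLV Λ Γ ω →
      MvPolynomial.eval (evalParam DV DLV Λ Γ ω) g ≠ 0 →
      MvPolynomial.eval (sigmaEval Λ Γ ω) q ≠ 0 ∧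
      Λ w v * MvPolynomial.eval (sigmaEval Λ Γ ω) q
        = MvPolynomial.eval (sigmaEval Λ Γ ω) p

/-- The entry `Ω_{ij}` of the latent covariance matrix is rationally identifiable. -/
def OmegaIdent (DV : Finset (V × V)) (DLV : Finset (L × V)) (i j : V) : Prop :=
  ∃ (p q : MvPolynomial (V × V) ℝ) (g : MvPolynomial (ParamVar DV DLV) ℝ),
    g ≠ 0 ∧
    ∀ (Λ : Matrix V V ℝ) (Γ : Matrix L V ℝ) (ω : V → ℝ),
      GoodParams DV DLV Λ Γ ω →
      MvPolynomial.eval (evalParam DV DLV Λ Γ ω) g ≠ 0 →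
      MvPolynomial.eval (sigmaEval Λ Γ ω) q ≠ 0 ∧
      (Matrix.diagonal ω + Γᵀ * Γ) i j * MvPolynomial.eval (sigmaEval Λ Γ ω) q
        = MvPolynomial.eval (sigmaEval Λ Γ ω) p

end Matrices

end LFG

namespace LFG
namespace CNF

variable (n M : ℕ) (C : Fin M → List (Fin n × Bool))

/-- Occurrences of literals in the CNF formula: positions in clauses. -/
abbrev Occ : Type := Σ k : Fin M, Fin (C k).length

/-- The literal at a given occurrence. -/
def lit (o : Occ n M C) : Fin n × Bool := (C o.1).get o.2

/-- The observed nodes of the graph `G_C`: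
the distinguished node `v`; the clause nodes `w_k`; the occurrence nodes
`u_{ij}` / `ū_{ij}` (one for each literal occurrence); the nodes `u_i`, `ū_i`;
and the nodes `q_i`. -/
abbrev ONode : Type :=
  Unit ⊕ Fin M ⊕ Occ n M C ⊕ (Fin n × Bool) ⊕ Fin n

/-- The distinguished node `v`. -/
def vN : ONode n M C := Sum.inl ()

/-- The clause node `w_k`. -/
def wN (k : Fin M) : ONode n M C := Sum.inr (Sum.inl k)

/-- The occurrence node `u_{ij}` resp. `ū_{ij}`. -/
def occN (o : Occ n M C) : ONode n M C := Sum.inr (Sum.inr (Sum.inl o))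

/-- The node `u_i` (for `b = true`) resp. `ū_i` (for `b = false`). -/
def uN (i : Fin n) (b : Bool) : ONode n M C :=
  Sum.inr (Sum.inr (Sum.inr (Sum.inl (i, b))))

/-- The node `q_i`. -/
def qN (i : Fin n) : ONode n M C := Sum.inr (Sum.inr (Sum.inr (Sum.inr i)))

/-- The group `{u_i, u_{i1}, …, u_{iA_i}}` (resp. `{ū_i, ū_{i1}, …, ū_{iB_i}}`):
`none` is `u_i` (resp. `ū_i`) and `some o` is an occurrence of the literal `(i, b)`. -/
abbrev GroupElem (i : Fin n) (b : Bool) : Type :=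
  Option {o : Occ n M C // lit n M C o = (i, b)}

/-- Group elements as observed nodes. -/
def gElemToONode {i : Fin n} {b : Bool} : GroupElem n M C i b → ONode n M C
  | none => uN n M C i b
  | some o => occN n M C o.1

/-- Index for the latent nodes `h_{ab}`: an unordered pair of distinct elements of a
group `{u_i, u_{i1}, …}` resp. `{ū_i, ū_{i1}, …}`. -/
abbrev PairIdx : Type :=
  Σ i : Fin n, Σ b : Bool, {p : Sym2 (GroupElem n M C i b) // ¬ p.IsDiag}

/-- The latent nodes of `G_C`: the nodes `h_{w_k v}`, the nodes `h_i` (for `b = true`)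
resp. `h_{ī}` (for `b = false`), and the pair nodes `h_{ab}`. -/
abbrev LNode : Type := Fin M ⊕ (Fin n × Bool) ⊕ PairIdx n M C

/-- The latent node `h_i` resp. `h_{ī}`. -/
def hN (i : Fin n) (b : Bool) : LNode n M C := Sum.inr (Sum.inl (i, b))

/-- The observed edges of `G_C`: `w_k → v` for all `k`, and `u_{ij} → w_k`
(resp. `ū_{ij} → w_k`) whenever the corresponding occurrence lies in clause `k`. -/
noncomputable def DV_C : Finset (ONode n M C × ONode n M C) :=
  (Finset.univ.image fun k : Fin M => (wN n M C k, vN n M C)) ∪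
  (Finset.univ.image fun o : Occ n M C => (occN n M C o, wN n M C o.1))

/-- The latent edges of `G_C`. -/
noncomputable def DLV_C : Finset (LNode n M C × ONode n M C) :=
  -- w_k ← h_{w_k v} → v
  (Finset.univ.image fun k : Fin M => ((Sum.inl k : LNode n M C), wN n M C k)) ∪
  (Finset.univ.image fun k : Fin M => ((Sum.inl k : LNode n M C), vN n M C)) ∪
  -- h_i → u_{ij} (resp. h_{ī} → ū_{ij})
  ((Finset.univ.filter fun p : (Fin n × Bool) × Occ n M C =>
      lit n M C p.2 = p.1).image
    fun p => (hN n M C p.1.1 p.1.2, occN n M C p.2)) ∪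
  -- h_i → u_i, h_i → q_i, h_i → v (and likewise for h_{ī})
  (Finset.univ.image fun ib : Fin n × Bool => (hN n M C ib.1 ib.2, uN n M C ib.1 ib.2)) ∪
  (Finset.univ.image fun ib : Fin n × Bool => (hN n M C ib.1 ib.2, qN n M C ib.1)) ∪
  (Finset.univ.image fun ib : Fin n × Bool => (hN n M C ib.1 ib.2, vN n M C)) ∪
  -- a ← h_{ab} → b
  ((Finset.univ.filter fun pq : PairIdx n M C × ONode n M C =>
      ∃ g, g ∈ pq.1.2.2.val ∧ gElemToONode n M C g = pq.2).image
    fun pq => ((Sum.inr (Sum.inr pq.1) : LNode n M C), pq.2))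

end CNF
end LFG

namespace LFG

section General

variable {V L : Type*} [DecidableEq V] [DecidableEq L]
  {DV : Finset (V × V)} {DLV : Finset (L × V)}

theorem mem_paV {v w : V} : w ∈ paV DV v ↔ (w, v) ∈ DV := by
  simp [paV]

theorem mem_paL {W : Finset V} {h : L} : h ∈ paL DLV W ↔ ∃ w ∈ W, (h, w) ∈ DLV := by
  simp [paL, and_comm]

/-- In a triple satisfying the LF-HTC, each latent node of `H` is used by exactly one half-trek
`y h ← h → z h` ending in `Z`, so the half-treks ending in the parents of `v` avoid `H`. -/
theorem SatisfiesLFHTC.exists_pairing {v : V} {Y Z : Finset V} {H : Finset L}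
    (hS : SatisfiesLFHTC DV DLV v Y Z H) :
    ∃ y z : L → V,
      (∀ h ∈ H, y h ∈ Y ∧ z h ∈ Z ∧ (h, y h) ∈ DLV ∧ (h, z h) ∈ DLV) ∧
      Set.InjOn y H ∧ Set.InjOn z H ∧
      ∀ w ∈ paV DV v, ∃ t : HalfTrek DV DLV,
        t.target = w ∧ t.source ∈ Y ∧ ∀ h, t.latent = some h → h ∉ H := by
  obtain ⟨-, -, -, hcard, hZpa, -, -, f, ⟨htarget, hsource, hnsi⟩, hfZ⟩ := hS
  have hsrc : ∀ b ∈ Z ∪ paV DV v, (f b).source ∈ Y := fun b hb =>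
    hsource ▸ Finset.mem_image_of_mem _ hb
  have hlat : ∀ a ∈ Z ∪ paV DV v, ∀ b ∈ Z ∪ paV DV v, ∀ h,
      (f a).latent = some h → (f b).latent = some h → a = b := by
    intro a ha b hb h hha hhb
    by_contra hab
    have := (hnsi a ha b hb hab).2.1
    simp [HalfTrek.lats, hha, hhb] at this
  have hinj : Set.InjOn (fun b => (f b).latent) Z := fun a ha b hb hab => by
    obtain ⟨h, -, hh, -⟩ := hfZ a ha
    exact hlat a (Finset.mem_union_left _ ha) b (Finset.mem_union_left _ hb) h hh
      (hab.symm.trans hh)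
  have himage : Z.image (fun b => (f b).latent) = H.image some := by
    refine Finset.eq_of_subset_of_card_le (Finset.image_subset_iff.2 fun b hb => ?_) ?_
    · obtain ⟨h, hhH, hh, -⟩ := hfZ b hb
      exact Finset.mem_image.2 ⟨h, hhH, hh.symm⟩
    · rw [Finset.card_image_of_injOn hinj, hcard]
      exact Finset.card_image_le
  have hsurj : ∀ h ∈ H, ∃ z ∈ Z, (f z).latent = some h := fun h hh =>
    Finset.mem_image.1 (himage ▸ Finset.mem_image_of_mem some hh)
  have : Nonempty V := ⟨v⟩
  choose! z hzZ hlz using hsurj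
  have htail : ∀ h ∈ H, (f (z h)).tail = [z h] := fun h hh => by
    obtain ⟨-, -, -, ht⟩ := hfZ _ (hzZ h hh)
    exact ht
  have hzinj : Set.InjOn z H := fun a ha b hb hab =>
    Option.some.inj ((hlz a ha).symm.trans (hab ▸ hlz b hb))
  refine ⟨fun h => (f (z h)).source, z, fun h hh => ⟨hsrc _ (Finset.mem_union_left _ (hzZ h hh)),
    hzZ h hh, (f (z h)).latent_src h (hlz h hh), ?_⟩, ?_, hzinj, ?_⟩
  · obtain ⟨x, hx, hhx⟩ := (f (z h)).latent_head h (hlz h hh)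
    rw [htail h hh] at hx
    simp only [List.head?_cons, Option.some.injEq] at hx
    exact hx ▸ hhx
  · intro a ha b hb hab
    by_contra hne
    have := (hnsi (z a) (Finset.mem_union_left _ (hzZ a ha)) (z b)
      (Finset.mem_union_left _ (hzZ b hb)) (fun h => hne (hzinj ha hb h))).1
    simp only [HalfTrek.leftV, Finset.disjoint_singleton] at this
    exact this hab
  · intro w hw
    refine ⟨f w, htarget w (Finset.mem_union_right _ hw), hsrc w (Finset.mem_union_right _ hw),
      fun h hh hhH => ?_⟩
    have : w = z h := hlat w (Finset.mem_union_right _ hw) (z h)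
      (Finset.mem_union_left _ (hzZ h hhH)) h hh (hlz h hhH)
    exact Finset.disjoint_left.1 hZpa (hzZ h hhH) (this ▸ hw)

end General

namespace CNF

variable {n M : ℕ} {C : Fin M → List (Fin n × Bool)}

theorem mem_DV_C {x y : ONode n M C} :
    (x, y) ∈ DV_C n M C ↔
      (∃ k, x = wN n M C k ∧ y = vN n M C) ∨
        ∃ o : Occ n M C, x = occN n M C o ∧ y = wN n M C o.1 := by
  simp only [DV_C, Finset.mem_union, Finset.mem_image, Finset.mem_univ, true_and, Prod.mk.injEq,
    eq_comm]

theorem mem_paV_vN {w : ONode n M C} :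
    w ∈ paV (DV_C n M C) (vN n M C) ↔ ∃ k, w = wN n M C k := by
  simp [mem_paV, mem_DV_C, vN, wN]

theorem mem_DLV_C_clause {k : Fin M} {x : ONode n M C} :
    (Sum.inl k, x) ∈ DLV_C n M C ↔ x = wN n M C k ∨ x = vN n M C := by
  simp [DLV_C, hN, eq_comm]

theorem mem_DLV_C_hN {i : Fin n} {b : Bool} {x : ONode n M C} :
    (hN n M C i b, x) ∈ DLV_C n M C ↔
      (∃ g : GroupElem n M C i b, x = gElemToONode n M C g) ∨ x = qN n M C i ∨ x = vN n M C := by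
  simp only [DLV_C, hN, gElemToONode, Option.exists, Finset.mem_union, Finset.mem_image,
    Finset.mem_univ, Finset.mem_filter, true_and, Prod.mk.injEq, Sum.inr.injEq, Sum.inl.injEq,
    reduceCtorEq, false_and, exists_false, and_false, false_or, or_false, Prod.exists,
    Subtype.exists, exists_prop]
  constructor
  · rintro (((⟨_, _, o, ho, ⟨rfl, rfl⟩, rfl⟩ | ⟨_, _, ⟨rfl, rfl⟩, rfl⟩) |
      ⟨_, _, ⟨rfl, rfl⟩, rfl⟩) | ⟨_, _, ⟨rfl, rfl⟩, rfl⟩)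
    · exact Or.inl (Or.inr ⟨o, ho, rfl⟩)
    · exact Or.inl (Or.inl rfl)
    · exact Or.inr (Or.inl rfl)
    · exact Or.inr (Or.inr rfl)
  · rintro ((rfl | ⟨o, ho, rfl⟩) | rfl | rfl)
    · exact Or.inl (Or.inl (Or.inr ⟨i, b, ⟨rfl, rfl⟩, rfl⟩))
    · exact Or.inl (Or.inl (Or.inl ⟨i, b, o, ho, ⟨rfl, rfl⟩, rfl⟩))
    · exact Or.inl (Or.inr ⟨i, b, ⟨rfl, rfl⟩, rfl⟩)
    · exact Or.inr ⟨i, b, ⟨rfl, rfl⟩, rfl⟩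

theorem mem_DLV_C_pair {p : PairIdx n M C} {x : ONode n M C} :
    (Sum.inr (Sum.inr p), x) ∈ DLV_C n M C ↔
      ∃ g ∈ p.2.2.val, x = gElemToONode n M C g := by
  simp only [DLV_C, hN, Finset.mem_union, Finset.mem_image, Finset.mem_filter, Finset.mem_univ,
    true_and, Prod.mk.injEq, Sum.inr.injEq, reduceCtorEq, false_and, exists_false, and_false,
    false_or, Prod.exists]
  constructor
  · rintro ⟨_, _, ⟨g, hg, rfl⟩, rfl, rfl⟩
    exact ⟨g, hg, rfl⟩
  · rintro ⟨g, hg, rfl⟩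
    exact ⟨p, _, ⟨g, hg, rfl⟩, rfl, rfl⟩

theorem hN_mem_DLV_C_occN {i : Fin n} {b : Bool} {o : Occ n M C} :
    (hN n M C i b, occN n M C o) ∈ DLV_C n M C ↔ lit n M C o = (i, b) := by
  simp [mem_DLV_C_hN, gElemToONode, Option.exists, occN, uN, qN, vN]

theorem occN_eq_gElemToONode {i : Fin n} {b : Bool} {o : Occ n M C} {g : GroupElem n M C i b}
    (h : occN n M C o = gElemToONode n M C g) : lit n M C o = (i, b) :=
  hN_mem_DLV_C_occN.1 (mem_DLV_C_hN.2 (Or.inl ⟨g, h⟩))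

/-- Every half-trek to a clause node `w_k` is trivial, is of the form `x ← h → w_k`, or passes
through an occurrence node of the clause. -/
theorem halfTrek_to_wN (t : HalfTrek (DV_C n M C) (DLV_C n M C)) {k : Fin M}
    (ht : t.target = wN n M C k) :
    t.source = wN n M C k ∨
    (∃ h, t.latent = some h ∧ (h, t.source) ∈ DLV_C n M C ∧ (h, wN n M C k) ∈ DLV_C n M C) ∨
    ∃ o : Occ n M C, o.1 = k ∧ (t.source = occN n M C o ∨
      ∃ h, t.latent = some h ∧ (h, t.source) ∈ DLV_C n M C ∧ (h, occN n M C o) ∈ DLV_C n M C) := by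
  obtain ⟨s, l, tail, hchain, hs, hls, hlh⟩ := t
  simp only [HalfTrek.target] at ht ⊢
  match tail with
  | [] => exact Or.inl ht
  | [x] =>
    obtain rfl : x = wN n M C k := ht
    cases l with
    | none =>
      have := hs rfl _ rfl
      simp only [mem_DV_C, wN, vN, Sum.inr.injEq, Sum.inl.injEq, reduceCtorEq, and_false,
        exists_false, false_or] at this
      obtain ⟨o, h1, h2⟩ := this
      exact Or.inr (Or.inr ⟨o, h2.symm, Or.inl h1⟩)
    | some h =>
      obtain ⟨_, h1, h2⟩ := hlh h rfl
      cases h1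
      exact Or.inr (Or.inl ⟨h, rfl, hls h rfl, h2⟩)
  | [x, y] =>
    obtain rfl : y = wN n M C k := ht
    have hxy := (List.isChain_cons_cons.1 hchain).1
    simp only [mem_DV_C, wN, vN, Sum.inr.injEq, Sum.inl.injEq, reduceCtorEq, and_false,
      exists_false, false_or] at hxy
    obtain ⟨o, rfl, ho⟩ := hxy
    cases l with
    | none =>
      have := hs rfl _ rfl
      simp [mem_DV_C, occN, wN, vN] at this
    | some h =>
      obtain ⟨_, h1, h2⟩ := hlh h rfl
      cases h1
      exact Or.inr (Or.inr ⟨o, ho.symm, Or.inr ⟨h, rfl, hls h rfl, h2⟩⟩)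
  | x :: y :: z :: r =>
    exfalso
    obtain ⟨hxy, hchain⟩ := List.isChain_cons_cons.1 hchain
    obtain ⟨hyz, hr⟩ := List.isChain_cons_cons.1 hchain
    rw [mem_DV_C] at hxy hyz
    have hz : z = vN n M C := by
      rcases hyz with ⟨_, -, rfl⟩ | ⟨_, rfl, rfl⟩
      · rfl
      · simp [occN, wN, vN] at hxy
    subst hz
    cases r with
    | nil => simp [vN, wN] at ht
    | cons a r =>
      simp [List.isChain_cons_cons, mem_DV_C, vN, wN, occN] at hr

section Converse

variable {Y Z : Finset (ONode n M C)} {H : Finset (LNode n M C)}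

/-- Every clause contains a literal whose latent node lies in `H`. -/
theorem exists_lit_mem (hS : SatisfiesLFHTC (DV_C n M C) (DLV_C n M C) (vN n M C) Y Z H)
    (k : Fin M) : ∃ l ∈ C k, hN n M C l.1 l.2 ∈ H := by
  obtain ⟨y, z, hyz, -, -, htreks⟩ := hS.exists_pairing
  obtain ⟨hvY, hvZ, -, -, hZpa, -, hpa, -⟩ := hS
  have hH : ∀ h x, x ∈ Y → (h, x) ∈ DLV_C n M C → (h, vN n M C) ∈ DLV_C n M C → h ∈ H :=
    fun h x hx h1 h2 => hpa (Finset.mem_inter.2 ⟨mem_paL.2 ⟨x, hx, h1⟩,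
      mem_paL.2 ⟨_, Finset.mem_insert_self _ _, h2⟩⟩)
  have hwY : wN n M C k ∉ Y := by
    intro hw
    have hk := hH _ _ hw (mem_DLV_C_clause.2 (Or.inl rfl)) (mem_DLV_C_clause.2 (Or.inr rfl))
    obtain ⟨-, h1, -, h2⟩ := hyz _ hk
    rcases mem_DLV_C_clause.1 h2 with h | h
    · exact Finset.disjoint_left.1 hZpa h1 (h ▸ mem_paV_vN.2 ⟨k, rfl⟩)
    · exact hvZ (h ▸ h1)
  obtain ⟨t, ht, htY, htH⟩ := htreks _ (mem_paV_vN.2 ⟨k, rfl⟩)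
  suffices ∃ o : Occ n M C, o.1 = k ∧ hN n M C (lit n M C o).1 (lit n M C o).2 ∈ H by
    obtain ⟨o, rfl, ho⟩ := this
    exact ⟨_, List.get_mem _ _, ho⟩
  rcases halfTrek_to_wN t ht with h | ⟨h, hh, h1, h2⟩ | ⟨o, hok, ho⟩
  · exact absurd (h ▸ htY) hwY
  · exfalso
    rcases h with k' | ⟨i, b⟩ | p
    · rcases mem_DLV_C_clause.1 h2 with h | h
      · obtain rfl : k = k' := by simpa [wN] using h
        rcases mem_DLV_C_clause.1 h1 with h | h
        · exact hwY (h ▸ htY)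
        · exact hvY (h ▸ htY)
      · simp [wN, vN] at h
    · have := mem_DLV_C_hN.1 h2
      simp [Option.exists, gElemToONode, wN, uN, occN, qN, vN] at this
    · obtain ⟨g, -, hg⟩ := mem_DLV_C_pair.1 h2
      cases g <;> simp [gElemToONode, wN, uN, occN] at hg
  · refine ⟨o, hok, ?_⟩
    have hv : (hN n M C (lit n M C o).1 (lit n M C o).2, vN n M C) ∈ DLV_C n M C :=
      mem_DLV_C_hN.2 (Or.inr (Or.inr rfl))
    rcases ho with ho | ⟨h, hh, h1, h2⟩
    · exact hH _ _ htY (ho ▸ hN_mem_DLV_C_occN.2 rfl) hv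
    · rcases h with k' | ⟨i, b⟩ | ⟨i, b, p⟩
      · have := mem_DLV_C_clause.1 h2
        simp [occN, wN, vN] at this
      · exact absurd (hH _ _ htY h1 (mem_DLV_C_hN.2 (Or.inr (Or.inr rfl)))) (htH _ hh)
      · obtain ⟨g, -, hg⟩ := mem_DLV_C_pair.1 h1
        obtain ⟨g', -, hg'⟩ := mem_DLV_C_pair.1 h2
        have hlit := occN_eq_gElemToONode hg'
        refine hH _ _ htY ?_ hv
        rw [hlit]
        exact mem_DLV_C_hN.2 (Or.inl ⟨g, hg⟩)

/-- `H` never contains the latent nodes of both a literal and its negation. -/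
theorem not_both_mem (hS : SatisfiesLFHTC (DV_C n M C) (DLV_C n M C) (vN n M C) Y Z H)
    (i : Fin n) : ¬ (hN n M C i true ∈ H ∧ hN n M C i false ∈ H) := by
  obtain ⟨y, z, hyz, hyinj, hzinj, -⟩ := hS.exists_pairing
  obtain ⟨hvY, hvZ, -, -, -, hYZ, hpa, -⟩ := hS
  have hYZ' : ∀ x ∈ Y, x ∉ Z := fun x hx hxZ =>
    Finset.disjoint_left.1 hYZ hx (Finset.mem_insert_of_mem hxZ)
  have hgroup : ∀ b, hN n M C i b ∈ H → ∀ g g' : GroupElem n M C i b,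
      y (hN n M C i b) = gElemToONode n M C g → z (hN n M C i b) ≠ gElemToONode n M C g' := by
    intro b hb g g' hg hg'
    obtain ⟨hyY, hzZ, -, -⟩ := hyz _ hb
    have hne : g ≠ g' := by
      rintro rfl
      exact hYZ' _ hyY (hg.trans hg'.symm ▸ hzZ)
    have hpH : (Sum.inr (Sum.inr ⟨i, b, s(g, g'), hne⟩) : LNode n M C) ∈ H :=
      hpa (Finset.mem_inter.2
      ⟨mem_paL.2 ⟨_, hyY, mem_DLV_C_pair.2 ⟨g, by simp, hg⟩⟩,
        mem_paL.2 ⟨_, Finset.mem_insert_of_mem hzZ, mem_DLV_C_pair.2 ⟨g', by simp, hg'⟩⟩⟩)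
    obtain ⟨-, hpZ, -, hpz⟩ := hyz _ hpH
    obtain ⟨g'', hg'', hzg⟩ := mem_DLV_C_pair.1 hpz
    rcases Sym2.mem_iff.1 hg'' with h | h
    · rw [h, ← hg] at hzg
      exact hYZ' _ hyY (hzg ▸ hpZ)
    · rw [h, ← hg'] at hzg
      have := hzinj hpH hb hzg
      simp [hN] at this
  have hcases : ∀ b, hN n M C i b ∈ H →
      y (hN n M C i b) = qN n M C i ∨ z (hN n M C i b) = qN n M C i := by
    intro b hb
    obtain ⟨hyY, hzZ, hy, hz⟩ := hyz _ hb
    rcases mem_DLV_C_hN.1 hy with ⟨g, hg⟩ | h | h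
    · rcases mem_DLV_C_hN.1 hz with ⟨g', hg'⟩ | h | h
      · exact absurd hg' (hgroup b hb g g' hg)
      · exact Or.inr h
      · exact absurd (h ▸ hzZ) hvZ
    · exact Or.inl h
    · exact absurd (h ▸ hyY) hvY
  rintro ⟨ht, hf⟩
  have hne : hN n M C i true ≠ hN n M C i false := by simp [hN]
  rcases hcases _ ht with h1 | h1 <;> rcases hcases _ hf with h2 | h2
  · exact hne (hyinj ht hf (h1.trans h2.symm))
  · exact hYZ' _ (hyz _ ht).1 (h1.trans h2.symm ▸ (hyz _ hf).2.1)
  · exact hYZ' _ (hyz _ hf).1 (h2.trans h1.symm ▸ (hyz _ ht).2.1)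
  · exact hne (hzinj ht hf (h1.trans h2.symm))

end Converse

section Forward

/-- The half-trek `u_{ij} → w_k` for an occurrence in the clause `k`. -/
def occTrek (o : Occ n M C) : HalfTrek (DV_C n M C) (DLV_C n M C) where
  source := occN n M C o
  latent := none
  tail := [wN n M C o.1]
  chain := List.isChain_singleton _
  src_edge := by
    simp only [List.head?_cons, Option.mem_def, Option.some.injEq, forall_eq', forall_const]
    exact mem_DV_C.2 (Or.inr ⟨o, rfl, rfl⟩)
  latent_src := by simp
  latent_head := by simp

/-- The half-trek `u_i ← h_i → q_i`, respectively `ū_i ← h_{ī} → q_i`. -/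
def varTrek (i : Fin n) (b : Bool) : HalfTrek (DV_C n M C) (DLV_C n M C) where
  source := uN n M C i b
  latent := some (hN n M C i b)
  tail := [qN n M C i]
  chain := List.isChain_singleton _
  src_edge := by simp
  latent_src := by
    rintro _ ⟨⟩
    exact mem_DLV_C_hN.2 (Or.inl ⟨none, rfl⟩)
  latent_head := by
    rintro _ ⟨⟩
    exact ⟨_, rfl, mem_DLV_C_hN.2 (Or.inr (Or.inl rfl))⟩

/-- The trivial half-trek at an observed node. -/
def trivialTrek (x : ONode n M C) : HalfTrek (DV_C n M C) (DLV_C n M C) where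
  source := x
  latent := none
  tail := []
  chain := List.isChain_nil
  src_edge := by simp
  latent_src := by simp
  latent_head := by simp

/-- The half-treks, indexed by their targets, given by an assignment and a choice of one
occurrence in each clause. -/
def assignmentTreks (a : Fin n → Bool) (o : (k : Fin M) → Fin (C k).length) :
    ONode n M C → HalfTrek (DV_C n M C) (DLV_C n M C)
  | Sum.inr (Sum.inl k) => occTrek ⟨k, o k⟩
  | Sum.inr (Sum.inr (Sum.inr (Sum.inr i))) => varTrek i (a i)
  | x => trivialTrek x

theorem satisfiesLFHTC_of_assignment (a : Fin n → Bool) (o : (k : Fin M) → Fin (C k).length)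
    (ho : ∀ k, a (lit n M C ⟨k, o k⟩).1 = (lit n M C ⟨k, o k⟩).2) :
    SatisfiesLFHTC (DV_C n M C) (DLV_C n M C) (vN n M C)
      ((Finset.univ.image fun k => occN n M C ⟨k, o k⟩) ∪
        Finset.univ.image fun i => uN n M C i (a i))
      (Finset.univ.image (qN n M C)) (Finset.univ.image fun i => hN n M C i (a i)) := by
  have hpaV : paV (DV_C n M C) (vN n M C) = Finset.univ.image (wN n M C) := by
    ext w
    simp [mem_paV_vN, eq_comm]
  have hw : Function.Injective (wN n M C) := fun _ _ h => by simpa [wN] using h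
  have hq : Function.Injective (qN n M C) := fun _ _ h => by simpa [qN] using h
  have hh : Function.Injective fun i => hN n M C i (a i) := fun _ _ h => by
    simp only [hN, Sum.inr.injEq, Sum.inl.injEq, Prod.mk.injEq] at h
    exact h.1
  have hu : Function.Injective fun i => uN n M C i (a i) := fun _ _ h => by
    simp only [uN, Sum.inr.injEq, Sum.inl.injEq, Prod.mk.injEq] at h
    exact h.1
  have hocc : Function.Injective fun k => occN n M C ⟨k, o k⟩ := fun _ _ h => by
    simp only [occN, Sum.inr.injEq, Sum.inl.injEq, Sigma.mk.injEq] at h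
    exact h.1
  refine ⟨by simp [vN, occN, uN], by simp [vN, qN], ?_, ?_, ?_, ?_, ?_,
    assignmentTreks a o, ⟨?_, ?_, ?_⟩, ?_⟩
  · rw [hpaV, Finset.card_union_of_disjoint, Finset.card_image_of_injective _ hocc,
      Finset.card_image_of_injective _ hu, Finset.card_image_of_injective _ hw,
      Finset.card_image_of_injective _ hh]
    simp [Finset.disjoint_left, occN, uN]
  · rw [Finset.card_image_of_injective _ hq, Finset.card_image_of_injective _ hh]
  · simp [hpaV, Finset.disjoint_left, qN, wN]
  · simp [Finset.disjoint_left, occN, uN, vN, qN]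
  · intro h hmem
    obtain ⟨h1, h2⟩ := Finset.mem_inter.1 hmem
    obtain ⟨x, hx, hhx⟩ := mem_paL.1 h1
    obtain ⟨x', hx', hhx'⟩ := mem_paL.1 h2
    simp only [Finset.mem_union, Finset.mem_image, Finset.mem_univ, true_and,
      Finset.mem_insert] at hx hx' ⊢
    rcases h with k | ⟨i, b⟩ | p
    · have := mem_DLV_C_clause.1 hhx
      rcases hx with ⟨_, rfl⟩ | ⟨_, rfl⟩ <;> simp [occN, uN, wN, vN] at this
    · refine ⟨i, ?_⟩
      rcases hx with ⟨k, rfl⟩ | ⟨j, rfl⟩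
      · have h3 := ho k
        rw [hN_mem_DLV_C_occN.1 hhx] at h3
        rw [h3]
        rfl
      · have := mem_DLV_C_hN.1 hhx
        simp only [Option.exists, gElemToONode, uN, occN, qN, vN, Sum.inr.injEq, Sum.inl.injEq,
          Prod.mk.injEq, reduceCtorEq, exists_false, or_false] at this
        obtain ⟨rfl, rfl⟩ := this
        rfl
    · obtain ⟨g, -, hg⟩ := mem_DLV_C_pair.1 hhx'
      rcases hx' with rfl | ⟨_, rfl⟩ <;> cases g <;>
        simp [gElemToONode, uN, occN, qN, vN] at hg
  · rw [hpaV]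
    simp only [Finset.mem_union, Finset.mem_image, Finset.mem_univ, true_and]
    rintro _ (⟨i, rfl⟩ | ⟨k, rfl⟩) <;> rfl
  · rw [hpaV, Finset.image_union, Finset.image_image, Finset.image_image, Finset.union_comm]
    rfl
  · rw [hpaV]
    simp only [Finset.mem_union, Finset.mem_image, Finset.mem_univ, true_and]
    rintro _ (⟨i, rfl⟩ | ⟨k, rfl⟩) _ (⟨j, rfl⟩ | ⟨l, rfl⟩) hne
    · have : i ≠ j := fun h => hne (h ▸ rfl)
      simp [NSI, assignmentTreks, varTrek, qN, HalfTrek.leftV, HalfTrek.lats, HalfTrek.rightV, uN,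
        hN, this]
    · simp [NSI, assignmentTreks, varTrek, occTrek, qN, wN, HalfTrek.leftV, HalfTrek.lats,
        HalfTrek.rightV, uN, occN]
    · simp [NSI, assignmentTreks, varTrek, occTrek, qN, wN, HalfTrek.leftV, HalfTrek.lats,
        HalfTrek.rightV, uN, occN]
    · have : k ≠ l := fun h => hne (h ▸ rfl)
      simp [NSI, assignmentTreks, occTrek, wN, HalfTrek.leftV, HalfTrek.lats,
        HalfTrek.rightV, occN, this, this.symm]
  · simp only [Finset.mem_image, Finset.mem_univ, true_and]
    rintro _ ⟨i, rfl⟩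
    exact ⟨_, ⟨i, rfl⟩, rfl, rfl⟩

end Forward

end CNF
end LFG

open LFG LFG.CNF

/-- **Theorem 12 (NP-hardness reduction): the CNF formula `C` is satisfiable if and only
if some triple `(Y, Z, H)` satisfies the LF-HTC with respect to the distinguished node
`v` in the latent-factor graph `G_C`.** -/
theorem cnf_satisfiable_iff_lfhtc
    (n M : ℕ) (C : Fin M → List (Fin n × Bool)) :
    (∃ a : Fin n → Bool, ∀ k : Fin M, ∃ l ∈ C k, a l.1 = l.2) ↔
    (∃ (Y Z : Finset (ONode n M C)) (H : Finset (LNode n M C)),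
      SatisfiesLFHTC (DV_C n M C) (DLV_C n M C) (vN n M C) Y Z H) := by
  constructor
  · rintro ⟨a, ha⟩
    choose l hl hal using ha
    choose o ho using fun k => List.get_of_mem (hl k)
    refine ⟨_, _, _, satisfiesLFHTC_of_assignment a o fun k => ?_⟩
    rw [lit, ho, hal]
  · rintro ⟨Y, Z, H, hS⟩
    refine ⟨fun i => decide (hN n M C i true ∈ H), fun k => ?_⟩
    obtain ⟨⟨i, b⟩, hl, hH⟩ := exists_lit_mem hS k
    refine ⟨(i, b), hl, ?_⟩
    cases b with
    | true => simpa using hH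
    | false => simpa using fun h => not_both_mem hS i ⟨h, hH⟩
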